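/- Let β ∈ (1/2, 3/4) and let ψ : ℝ → ℝ be integrable with integrable Fourier transform ψ̂. Then there exists δ₀ > 0 such that for every δ ∈ (0, δ₀) and every choice of signs μ₁, μ₂, μ₃, μ₄ ∈ {−1, 1}, the integral ∫_{ℝ⁴} |ψ̂(x)| |ψ̂(y)| |ψ̂(z)| |ψ̂(x+y−z)| / ( |u|^{1−β−δμ₁} · |x+y−u|^{1−β−δμ₂} · |x−u|^{1−β−δμ₃} · |z−u|^{1−β−δμ₄} ) du dx dy dz is finite. -/

import Mathlib

open MeasureTheory Set

/-- The Fourier transform `ψ̂(λ) = ∫ e^{-iuλ} ψ(u) du` of an integrable `ψ : ℝ → ℝ`. -/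
noncomputable def Fhat (ψ : ℝ → ℝ) (l : ℝ) : ℂ :=
  ∫ u : ℝ, Complex.exp (-Complex.I * u * l) * (ψ u : ℂ)

open scoped ENNReal

section FourfoldIntegral

lemma lintegral_fourfold_lt_top {k : ℝ × ℝ × ℝ × ℝ → ℝ≥0∞} {A : ℝ → ℝ≥0∞} {B : ℝ → ℝ → ℝ≥0∞}
    {C : ℝ → ℝ → ℝ → ℝ≥0∞} {D : ℝ → ℝ → ℝ → ℝ → ℝ≥0∞} {a b c d : ℝ≥0∞}
    (hk : ∀ u x y z, k (u, x, y, z) ≤ A u * (B u x * (C u x y * D u x y z)))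
    (hmA : Measurable A) (hmB : ∀ u, Measurable (B u)) (hmC : ∀ u x, Measurable (C u x))
    (hmD : ∀ u x y, Measurable (D u x y))
    (hA : ∫⁻ u, A u ≤ a) (hB : ∀ u, ∫⁻ x, B u x ≤ b) (hC : ∀ u x, ∫⁻ y, C u x y ≤ c)
    (hD : ∀ u x y, ∫⁻ z, D u x y z ≤ d) (ha : a < ⊤) (hb : b < ⊤) (hc : c < ⊤) (hd : d < ⊤) :
    ∫⁻ q, k q < ⊤ := by
  have hz (u x y : ℝ) : ∫⁻ z, k (u, x, y, z) ≤ A u * (B u x * (C u x y * d)) := by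
    calc _ ≤ ∫⁻ z, A u * (B u x * C u x y) * D u x y z :=
          lintegral_mono fun z => (hk u x y z).trans_eq (by ring)
      _ = A u * (B u x * C u x y) * ∫⁻ z, D u x y z := lintegral_const_mul _ (hmD u x y)
      _ ≤ A u * (B u x * C u x y) * d := by gcongr; exact hD u x y
      _ = _ := by ring
  have hy (u x : ℝ) : ∫⁻ r, k (u, x, r) ≤ A u * (B u x * (c * d)) := by
    calc _ ≤ ∫⁻ y, ∫⁻ z, k (u, x, y, z) := lintegral_prod_le _
      _ ≤ ∫⁻ y, A u * (B u x * d) * C u x y :=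
          lintegral_mono fun y => (hz u x y).trans_eq (by ring)
      _ = A u * (B u x * d) * ∫⁻ y, C u x y := lintegral_const_mul _ (hmC u x)
      _ ≤ A u * (B u x * d) * c := by gcongr; exact hC u x
      _ = _ := by ring
  have hx (u : ℝ) : ∫⁻ r, k (u, r) ≤ A u * (b * (c * d)) := by
    calc _ ≤ ∫⁻ x, ∫⁻ r, k (u, x, r) := lintegral_prod_le _
      _ ≤ ∫⁻ x, A u * (c * d) * B u x :=
          lintegral_mono fun x => (hy u x).trans_eq (by ring)
      _ = A u * (c * d) * ∫⁻ x, B u x := lintegral_const_mul _ (hmB u)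
      _ ≤ A u * (c * d) * b := by gcongr; exact hB u
      _ = _ := by ring
  calc ∫⁻ q, k q ≤ ∫⁻ u, ∫⁻ r, k (u, r) := lintegral_prod_le _
    _ ≤ ∫⁻ u, A u * (b * (c * d)) := lintegral_mono hx
    _ = (∫⁻ u, A u) * (b * (c * d)) := lintegral_mul_const _ hmA
    _ ≤ a * (b * (c * d)) := by gcongr
    _ < ⊤ := ENNReal.mul_lt_top ha (ENNReal.mul_lt_top hb (ENNReal.mul_lt_top hc hd))

lemma lintegral_prod_comp_sub_fst {X : Type*} [MeasurableSpace X] {μ : Measure X} [SFinite μ]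
    {k : ℝ × X → ℝ≥0∞} (hk : Measurable k) {c : X → ℝ} (hc : Measurable c) :
    ∫⁻ q, k (c q.2 - q.1, q.2) ∂((volume : Measure ℝ).prod μ)
      = ∫⁻ q, k q ∂((volume : Measure ℝ).prod μ) := by
  rw [lintegral_prod_symm' _ hk, lintegral_prod_symm' _ (by fun_prop)]
  exact lintegral_congr fun w => lintegral_sub_left_eq_self (fun u => k (u, w)) (c w)

variable {f h : ℝ → ℝ≥0∞} {M : ℝ≥0∞}

lemma lintegral_weight_mul_single_lt_top (hf : Measurable f) (hh : Measurable h)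
    (hfi : ∫⁻ t, f t < ⊤) (hhi : ∫⁻ t, h t < ⊤) (hM : M < ⊤) (hfM : ∀ t, f t ≤ M)
    {c : ℝ × ℝ × ℝ → ℝ} (hc : Measurable c) :
    ∫⁻ q : ℝ × ℝ × ℝ × ℝ, f q.2.1 * f q.2.2.1 * f q.2.2.2 * f (q.2.1 + q.2.2.1 - q.2.2.2) *
      h (c q.2 - q.1) < ⊤ := by
  have key : ∫⁻ q : ℝ × ℝ × ℝ × ℝ, f q.2.1 * f q.2.2.1 * f q.2.2.2 *
      f (q.2.1 + q.2.2.1 - q.2.2.2) * h q.1 < ⊤ := by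
    refine lintegral_fourfold_lt_top (A := fun u => h u * M) (B := fun _ x => f x)
      (C := fun _ _ y => f y) (D := fun _ _ _ z => f z) (fun u x y z => ?_)
      (by fun_prop) (by fun_prop) (by fun_prop) (by fun_prop) le_rfl (fun _ => le_rfl)
      (fun _ _ => le_rfl) (fun _ _ _ => le_rfl) ?_ hfi hfi hfi
    · calc _ ≤ f x * f y * f z * M * h u := by gcongr; exact hfM _
        _ = _ := by ring
    · rw [lintegral_mul_const _ hh]
      exact ENNReal.mul_lt_top hhi hM
  exact (lintegral_prod_comp_sub_fst (μ := (volume : Measure (ℝ × ℝ × ℝ)))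
    (k := fun q => f q.2.1 * f q.2.2.1 * f q.2.2.2 * f (q.2.1 + q.2.2.1 - q.2.2.2) * h q.1)
    (by fun_prop) hc).trans_lt key

lemma lintegral_weight_mul_pair₁₃_lt_top (hf : Measurable f) (hh : Measurable h)
    (hfi : ∫⁻ t, f t < ⊤) (hhi : ∫⁻ t, h t < ⊤) (hM : M < ⊤) (hfM : ∀ t, f t ≤ M) :
    ∫⁻ q : ℝ × ℝ × ℝ × ℝ, f q.2.1 * f q.2.2.1 * f q.2.2.2 * f (q.2.1 + q.2.2.1 - q.2.2.2) *
      (h q.1 * h (q.2.1 - q.1)) < ⊤ := by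
  refine lintegral_fourfold_lt_top (A := fun u => h u * (M * M)) (B := fun u x => h (x - u))
    (C := fun _ _ y => f y) (D := fun _ _ _ z => f z) (fun u x y z => ?_)
    (by fun_prop) (by fun_prop) (by fun_prop) (by fun_prop) le_rfl
    (fun u => (lintegral_sub_right_eq_self h u).le)
    (fun _ _ => le_rfl) (fun _ _ _ => le_rfl) ?_ hhi hfi hfi
  · calc _ ≤ M * f y * f z * M * (h u * h (x - u)) := by gcongr <;> exact hfM _
      _ = _ := by ring
  · rw [lintegral_mul_const _ hh]
    exact ENNReal.mul_lt_top hhi (ENNReal.mul_lt_top hM hM)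

lemma lintegral_weight_mul_pair₁₄_lt_top (hf : Measurable f) (hh : Measurable h)
    (hfi : ∫⁻ t, f t < ⊤) (hhi : ∫⁻ t, h t < ⊤) (hM : M < ⊤) (hfM : ∀ t, f t ≤ M) :
    ∫⁻ q : ℝ × ℝ × ℝ × ℝ, f q.2.1 * f q.2.2.1 * f q.2.2.2 * f (q.2.1 + q.2.2.1 - q.2.2.2) *
      (h q.1 * h (q.2.2.2 - q.1)) < ⊤ := by
  refine lintegral_fourfold_lt_top (A := fun u => h u * (M * M)) (B := fun _ x => f x)
    (C := fun _ _ y => f y) (D := fun u _ _ z => h (z - u)) (fun u x y z => ?_)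
    (by fun_prop) (by fun_prop) (by fun_prop) (by fun_prop) le_rfl
    (fun _ => le_rfl) (fun _ _ => le_rfl)
    (fun u _ _ => (lintegral_sub_right_eq_self h u).le) ?_ hfi hfi hhi
  · calc _ ≤ f x * f y * M * M * (h u * h (z - u)) := by gcongr <;> exact hfM _
      _ = _ := by ring
  · rw [lintegral_mul_const _ hh]
    exact ENNReal.mul_lt_top hhi (ENNReal.mul_lt_top hM hM)

lemma lintegral_weight_mul_pair₂₃_lt_top (hf : Measurable f) (hh : Measurable h)
    (hfi : ∫⁻ t, f t < ⊤) (hhi : ∫⁻ t, h t < ⊤) (hM : M < ⊤) (hfM : ∀ t, f t ≤ M) :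
    ∫⁻ q : ℝ × ℝ × ℝ × ℝ, f q.2.1 * f q.2.2.1 * f q.2.2.2 * f (q.2.1 + q.2.2.1 - q.2.2.2) *
      (h (q.2.1 + q.2.2.1 - q.1) * h (q.2.1 - q.1)) < ⊤ := by
  refine (lintegral_prod_comp_sub_fst (μ := (volume : Measure (ℝ × ℝ × ℝ)))
    (k := fun q => f q.2.1 * f q.2.2.1 * f q.2.2.2 * f (q.2.1 + q.2.2.1 - q.2.2.2) *
      (h (q.2.1 + q.2.2.1 - q.1) * h (q.2.1 - q.1)))
    (by fun_prop) (c := fun w => w.1) (by fun_prop)).symm.trans_lt ?_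
  refine lintegral_fourfold_lt_top (A := fun u => h u * (M * M)) (B := fun _ x => f x)
    (C := fun u _ y => h (y + u)) (D := fun _ _ _ z => f z) (fun u x y z => ?_)
    (by fun_prop) (by fun_prop) (by fun_prop) (by fun_prop) le_rfl
    (fun _ => le_rfl) (fun u _ => (lintegral_add_right_eq_self h u).le)
    (fun _ _ _ => le_rfl) ?_ hfi hhi hfi
  · calc _ ≤ f x * M * f z * M * (h (x + y - (x - u)) * h (x - (x - u))) := by
          gcongr <;> exact hfM _
      _ = _ := by
        rw [show x + y - (x - u) = y + u by ring, show x - (x - u) = u by ring]; ring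
  · rw [lintegral_mul_const _ hh]
    exact ENNReal.mul_lt_top hhi (ENNReal.mul_lt_top hM hM)

lemma lintegral_weight_mul_pair₂₄_lt_top (hf : Measurable f) (hh : Measurable h)
    (hfi : ∫⁻ t, f t < ⊤) (hhi : ∫⁻ t, h t < ⊤) (hM : M < ⊤) (hfM : ∀ t, f t ≤ M) :
    ∫⁻ q : ℝ × ℝ × ℝ × ℝ, f q.2.1 * f q.2.2.1 * f q.2.2.2 * f (q.2.1 + q.2.2.1 - q.2.2.2) *
      (h (q.2.1 + q.2.2.1 - q.1) * h (q.2.2.2 - q.1)) < ⊤ := by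
  refine (lintegral_prod_comp_sub_fst (μ := (volume : Measure (ℝ × ℝ × ℝ)))
    (k := fun q => f q.2.1 * f q.2.2.1 * f q.2.2.2 * f (q.2.1 + q.2.2.1 - q.2.2.2) *
      (h (q.2.1 + q.2.2.1 - q.1) * h (q.2.2.2 - q.1)))
    (by fun_prop) (c := fun w => w.2.2) (by fun_prop)).symm.trans_lt ?_
  refine lintegral_fourfold_lt_top (A := fun u => h u * (M * M)) (B := fun _ x => f x)
    (C := fun _ _ y => f y) (D := fun u x y z => h ((x + y + u) - z)) (fun u x y z => ?_)
    (by fun_prop) (by fun_prop) (by fun_prop) (by fun_prop) le_rfl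
    (fun _ => le_rfl) (fun _ _ => le_rfl)
    (fun u x y => (lintegral_sub_left_eq_self h (x + y + u)).le) ?_ hfi hfi hhi
  · calc _ ≤ f x * f y * M * M * (h (x + y - (z - u)) * h (z - (z - u))) := by
          gcongr <;> exact hfM _
      _ = _ := by
        rw [show x + y - (z - u) = x + y + u - z by ring, show z - (z - u) = u by ring]; ring
  · rw [lintegral_mul_const _ hh]
    exact ENNReal.mul_lt_top hhi (ENNReal.mul_lt_top hM hM)

/-- The majorant of the product of the four singular factors by single and pairwise products. -/
lemma lintegral_weight_mul_majorant_lt_top (hf : Measurable f) (hh : Measurable h)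
    (hfi : ∫⁻ t, f t < ⊤) (hhi : ∫⁻ t, h t < ⊤) (hM : M < ⊤) (hfM : ∀ t, f t ≤ M)
    (hsymm : ∀ t, h (-t) = h t) :
    ∫⁻ q : ℝ × ℝ × ℝ × ℝ, f q.2.1 * f q.2.2.1 * f q.2.2.2 * f (q.2.1 + q.2.2.1 - q.2.2.2) *
      (h q.1 * h (q.2.1 - q.1) + h q.1 * h (q.2.2.2 - q.1) +
        h (q.2.1 + q.2.2.1 - q.1) * h (q.2.1 - q.1) +
        h (q.2.1 + q.2.2.1 - q.1) * h (q.2.2.2 - q.1) +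
        2 * (h q.1 + h (q.2.1 + q.2.2.1 - q.1) + h (q.2.1 - q.1) + h (q.2.2.2 - q.1))) < ⊤ := by
  have h1 := lintegral_weight_mul_single_lt_top hf hh hfi hhi hM hfM
    (c := fun _ => 0) (by fun_prop)
  simp only [zero_sub, hsymm] at h1
  have h2 := lintegral_weight_mul_single_lt_top hf hh hfi hhi hM hfM
    (c := fun w => w.1 + w.2.1) (by fun_prop)
  have h3 := lintegral_weight_mul_single_lt_top hf hh hfi hhi hM hfM
    (c := fun w => w.1) (by fun_prop)
  have h4 := lintegral_weight_mul_single_lt_top hf hh hfi hhi hM hfM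
    (c := fun w => w.2.2) (by fun_prop)
  have h13 := lintegral_weight_mul_pair₁₃_lt_top hf hh hfi hhi hM hfM
  have h14 := lintegral_weight_mul_pair₁₄_lt_top hf hh hfi hhi hM hfM
  have h23 := lintegral_weight_mul_pair₂₃_lt_top hf hh hfi hhi hM hfM
  have h24 := lintegral_weight_mul_pair₂₄_lt_top hf hh hfi hhi hM hfM
  simp only [mul_add, mul_left_comm _ (2 : ℝ≥0∞)]
  repeat rw [lintegral_add_left (by fun_prop)]
  repeat rw [lintegral_const_mul _ (by fun_prop)]
  simp only [ENNReal.add_lt_top]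
  have two : (2 : ℝ≥0∞) < ⊤ := ENNReal.ofNat_lt_top
  exact ⟨⟨⟨⟨h13, h14⟩, h23⟩, h24⟩, ⟨⟨ENNReal.mul_lt_top two h1, ENNReal.mul_lt_top two h2⟩,
    ENNReal.mul_lt_top two h3⟩, ENNReal.mul_lt_top two h4⟩

end FourfoldIntegral

section SingularFactor

/-- An even function comparable to `|t| ^ (-p)` near the origin and to `|t| ^ (-q)` at infinity. -/
noncomputable def twoPower (p q t : ℝ) : ℝ := if |t| ≤ 1 then |t| ^ (-p) else |t| ^ (-q)

lemma twoPower_nonneg (p q t : ℝ) : 0 ≤ twoPower p q t := by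
  unfold twoPower; split_ifs <;> positivity

lemma twoPower_neg (p q t : ℝ) : twoPower p q (-t) = twoPower p q t := by simp [twoPower]

lemma measurable_twoPower (p q : ℝ) : Measurable (twoPower p q) := by
  unfold twoPower
  exact Measurable.ite (measurableSet_le (by fun_prop) (by fun_prop)) (by fun_prop) (by fun_prop)

lemma integrable_twoPower {p q : ℝ} (hp : p < 1) (hq : 1 < q) : Integrable (twoPower p q) := by
  have hpos : IntegrableOn (twoPower p q) (Ioi 0) := by
    rw [← Ioc_union_Ioi_eq_Ioi zero_le_one]
    refine IntegrableOn.union ?_ ?_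
    · have hint : IntegrableOn (fun t : ℝ => t ^ (-p)) (Ioc 0 1) :=
        (intervalIntegrable_iff_integrableOn_Ioc_of_le zero_le_one).1
          (intervalIntegral.intervalIntegrable_rpow' (by linarith))
      refine hint.congr_fun (fun t ht => ?_) measurableSet_Ioc
      simp [twoPower, abs_of_pos ht.1, ht.2]
    · refine (integrableOn_Ioi_rpow_of_lt (a := -q) (by linarith) zero_lt_one).congr_fun
        (fun t ht => ?_) measurableSet_Ioi
      have ht' : 1 < t := ht
      simp [twoPower, abs_of_pos (zero_lt_one.trans ht'), ht'.not_ge]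
  have hneg : IntegrableOn (twoPower p q) (Iio 0) := by
    have hcomp : IntegrableOn (fun t => twoPower p q (-t)) (Iio 0) :=
      IntegrableOn.comp_neg_Iio (c := 0) (by rwa [neg_zero])
    simpa only [twoPower_neg] using hcomp
  rw [← integrableOn_univ, ← Iic_union_Ioi (a := (0 : ℝ))]
  exact ((integrableOn_Iic_iff_integrableOn_Iio (by simp)).2 hneg).union hpos

lemma abs_rpow_neg_dichotomy {a p q : ℝ} (ha : 0 < a) (hp : 2 * a ≤ p) (hq : q ≤ 4 * a) (t : ℝ) :
    (|t| ^ (-a)) ^ 2 ≤ twoPower p q t ∨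
      (|t| ^ (-a)) ^ 2 ≤ 1 ∧ (|t| ^ (-a)) ^ 4 ≤ twoPower p q t := by
  rcases eq_or_ne t 0 with rfl | ht
  · left
    rw [abs_zero, Real.zero_rpow (by linarith)]
    simpa using twoPower_nonneg p q 0
  have h0 : 0 < |t| := abs_pos.2 ht
  have hpow (n : ℕ) : (|t| ^ (-a)) ^ n = |t| ^ (-(n * a)) := by
    rw [← Real.rpow_natCast, ← Real.rpow_mul h0.le]; congr 1; ring
  rw [hpow, hpow]
  by_cases h1 : |t| ≤ 1
  · left
    rw [twoPower, if_pos h1]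
    exact Real.rpow_le_rpow_of_exponent_ge h0 h1 (by push_cast; linarith)
  · right
    rw [twoPower, if_neg h1]
    push Not at h1
    exact ⟨Real.rpow_le_one_of_one_le_of_nonpos h1.le (by push_cast; linarith),
      Real.rpow_le_rpow_of_exponent_le h1.le (by push_cast; linarith)⟩

lemma sq_mul_sq_le_of_dichotomy {g g' H H' : ℝ} (hH : 0 ≤ H) (hH' : 0 ≤ H')
    (hg : g ^ 2 ≤ H ∨ g ^ 2 ≤ 1 ∧ g ^ 4 ≤ H) (hg' : g' ^ 2 ≤ H' ∨ g' ^ 2 ≤ 1 ∧ g' ^ 4 ≤ H') :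
    g ^ 2 * g' ^ 2 ≤ H * H' + (H + H') := by
  have hHH : 0 ≤ H * H' := mul_nonneg hH hH'
  rcases hg with h | ⟨h, h4⟩ <;> rcases hg' with h' | ⟨h', h4'⟩
  · linarith [mul_le_mul h h' (sq_nonneg g') hH]
  · linarith [mul_le_mul h h' (sq_nonneg g') hH]
  · linarith [mul_le_mul h h' (sq_nonneg g') zero_le_one]
  · nlinarith [sq_nonneg (g ^ 2 - g' ^ 2), sq_nonneg (g ^ 2 + g' ^ 2)]

lemma mul_four_le_of_dichotomy {g₁ g₂ g₃ g₄ H₁ H₂ H₃ H₄ : ℝ}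
    (h₁ : 0 ≤ H₁) (h₂ : 0 ≤ H₂) (h₃ : 0 ≤ H₃) (h₄ : 0 ≤ H₄)
    (hg₁ : g₁ ^ 2 ≤ H₁ ∨ g₁ ^ 2 ≤ 1 ∧ g₁ ^ 4 ≤ H₁) (hg₂ : g₂ ^ 2 ≤ H₂ ∨ g₂ ^ 2 ≤ 1 ∧ g₂ ^ 4 ≤ H₂)
    (hg₃ : g₃ ^ 2 ≤ H₃ ∨ g₃ ^ 2 ≤ 1 ∧ g₃ ^ 4 ≤ H₃) (hg₄ : g₄ ^ 2 ≤ H₄ ∨ g₄ ^ 2 ≤ 1 ∧ g₄ ^ 4 ≤ H₄) :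
    g₁ * g₂ * g₃ * g₄ ≤
      H₁ * H₃ + H₁ * H₄ + H₂ * H₃ + H₂ * H₄ + 2 * (H₁ + H₂ + H₃ + H₄) := by
  have h13 := sq_mul_sq_le_of_dichotomy h₁ h₃ hg₁ hg₃
  have h14 := sq_mul_sq_le_of_dichotomy h₁ h₄ hg₁ hg₄
  have h23 := sq_mul_sq_le_of_dichotomy h₂ h₃ hg₂ hg₃
  have h24 := sq_mul_sq_le_of_dichotomy h₂ h₄ hg₂ hg₄
  nlinarith [sq_nonneg (g₁ * g₃ - g₂ * g₄), sq_nonneg (g₁ * g₄), sq_nonneg (g₂ * g₃),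
    sq_nonneg (g₁ * g₃), sq_nonneg (g₂ * g₄)]

end SingularFactor

section FourierTransform

lemma norm_exp_mul_ofReal (u l r : ℝ) : ‖Complex.exp (-Complex.I * u * l) * (r : ℂ)‖ = ‖r‖ := by
  rw [norm_mul, show -Complex.I * u * l = ((-(u * l) : ℝ) : ℂ) * Complex.I by push_cast; ring,
    Complex.norm_exp_ofReal_mul_I, one_mul, Complex.norm_real]

lemma norm_Fhat_le (ψ : ℝ → ℝ) (l : ℝ) : ‖Fhat ψ l‖ ≤ ∫ u, ‖ψ u‖ := by
  refine (norm_integral_le_integral_norm _).trans_eq ?_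
  simp only [norm_exp_mul_ofReal]

lemma continuous_Fhat {ψ : ℝ → ℝ} (hψ : Integrable ψ) : Continuous (Fhat ψ) := by
  refine continuous_of_dominated (bound := fun u => ‖ψ u‖) (fun l => ?_) (fun l => ?_) hψ.norm ?_
  · exact (by fun_prop : Continuous fun u : ℝ =>
      Complex.exp (-Complex.I * u * l)).aestronglyMeasurable.mul hψ.ofReal.aestronglyMeasurable
  · exact Filter.Eventually.of_forall fun u => (norm_exp_mul_ofReal u l (ψ u)).le
  · exact Filter.Eventually.of_forall fun u => by fun_prop

end FourierTransform

/-- Lemma 4: for `β ∈ (1/2, 3/4)` there is `δ₀ > 0` such that for every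
`δ ∈ (0, δ₀)` and signs `μ₁, μ₂, μ₃, μ₄ ∈ {−1,1}` the singular fourfold integral
`∫ |ψ̂(x)||ψ̂(y)||ψ̂(z)||ψ̂(x+y−z)| / (|u|^{1−β−δμ₁}|x+y−u|^{1−β−δμ₂}|x−u|^{1−β−δμ₃}|z−u|^{1−β−δμ₄})`
is finite. -/
theorem stmt1 (β : ℝ) (hβ : β ∈ Set.Ioo (1/2 : ℝ) (3/4))
    (ψ : ℝ → ℝ) (hψ : Integrable ψ) (hψhat : Integrable (Fhat ψ)) :
    ∃ δ₀ > (0 : ℝ), ∀ δ ∈ Set.Ioo (0 : ℝ) δ₀,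
      ∀ μ₁ ∈ ({-1, 1} : Set ℝ), ∀ μ₂ ∈ ({-1, 1} : Set ℝ),
      ∀ μ₃ ∈ ({-1, 1} : Set ℝ), ∀ μ₄ ∈ ({-1, 1} : Set ℝ),
      ∫⁻ q : ℝ × ℝ × ℝ × ℝ,
        ENNReal.ofReal
          (‖Fhat ψ q.2.1‖ * ‖Fhat ψ q.2.2.1‖ * ‖Fhat ψ q.2.2.2‖ *
            ‖Fhat ψ (q.2.1 + q.2.2.1 - q.2.2.2)‖ *
            (|q.1| ^ (-(1 - β - δ * μ₁)) *
             |q.2.1 + q.2.2.1 - q.1| ^ (-(1 - β - δ * μ₂)) *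
             |q.2.1 - q.1| ^ (-(1 - β - δ * μ₃)) *
             |q.2.2.2 - q.1| ^ (-(1 - β - δ * μ₄))))
      < ⊤ := by
  obtain ⟨hβ1, hβ2⟩ := hβ
  refine ⟨min (β - 1 / 2) (3 / 4 - β), lt_min (by linarith) (by linarith), ?_⟩
  rintro δ ⟨hδ0, hδ⟩ μ₁ hμ₁ μ₂ hμ₂ μ₃ hμ₃ μ₄ hμ₄
  obtain ⟨hδ1, hδ2⟩ := lt_min_iff.1 hδ
  have hdich : ∀ μ ∈ ({-1, 1} : Set ℝ), ∀ t : ℝ, _ := fun μ hμ =>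
    abs_rpow_neg_dichotomy (a := 1 - β - δ * μ) (p := 2 * (1 - β + δ)) (q := 4 * (1 - β - δ))
      (by rcases hμ with rfl | rfl <;> linarith) (by rcases hμ with rfl | rfl <;> linarith)
      (by rcases hμ with rfl | rfl <;> linarith)
  set H := twoPower (2 * (1 - β + δ)) (4 * (1 - β - δ)) with hHdef
  have hH : Integrable H := integrable_twoPower (by linarith) (by linarith)
  have hHm : Measurable H := measurable_twoPower _ _
  have hH0 : ∀ t, 0 ≤ H t := twoPower_nonneg _ _
  have hFm : Measurable (Fhat ψ) := (continuous_Fhat hψ).measurable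
  refine (lintegral_mono fun q => ?_).trans_lt
    (lintegral_weight_mul_majorant_lt_top (f := fun t => ENNReal.ofReal ‖Fhat ψ t‖)
      (h := fun t => ENNReal.ofReal (H t)) (M := ENNReal.ofReal (∫ u, ‖ψ u‖)) (by fun_prop)
      (by fun_prop) hψhat.norm.lintegral_lt_top hH.lintegral_lt_top ENNReal.ofReal_lt_top
      (fun t => ENNReal.ofReal_le_ofReal (norm_Fhat_le ψ t))
      (fun t => by rw [hHdef, twoPower_neg]))
  obtain ⟨u, x, y, z⟩ := q
  have hbound := mul_four_le_of_dichotomy (hH0 u) (hH0 (x + y - u)) (hH0 (x - u)) (hH0 (z - u))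
    (hdich μ₁ hμ₁ u) (hdich μ₂ hμ₂ (x + y - u)) (hdich μ₃ hμ₃ (x - u)) (hdich μ₄ hμ₄ (z - u))
  have h1 := hH0 u
  have h2 := hH0 (x + y - u)
  have h3 := hH0 (x - u)
  have h4 := hH0 (z - u)
  refine (ENNReal.ofReal_le_ofReal (mul_le_mul_of_nonneg_left hbound (by positivity))).trans_eq ?_
  have two : (2 : ℝ≥0∞) = ENNReal.ofReal 2 := by simp
  simp only [two]
  repeat rw [ENNReal.ofReal_mul (by positivity)]
  repeat rw [ENNReal.ofReal_add (by positivity) (by positivity)]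
  repeat rw [ENNReal.ofReal_mul (by positivity)]
  repeat rw [ENNReal.ofReal_add (by positivity) (by positivity)]
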